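/- arXiv:2411.07105 — 2 statements merged into one kernel-verified Lean document; each statement's English description precedes it below -/
import Mathlib

section
/- For every integer n ≥ 3, the real inequality √((n−2)/(n−1)) < 2·n^{1/(n−1)} / (n^{2/(n−1)} + 1) holds; i.e., the new upper bound √((n−2)/(n−1)) is strictly smaller than Pawlowski's upper bound 2·n^{1/(n−1)}/(n^{2/(n−1)} + 1). -/
/-- The logarithm satisfies `n (log n)² ≤ (n - 1)²`, that is, `log n ≤ √n - 1/√n`. -/
lemma Real.sq_log_div_sub_one_le_inv {x : ℝ} (hx : 1 < x) :
    (Real.log x / (x - 1)) ^ 2 ≤ x⁻¹ := by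
  have hx0 : 0 < x := by linarith
  have hs : 0 < √x := Real.sqrt_pos.2 hx0
  have hlog : 0 < Real.log x := Real.log_pos hx
  have hsq : √x ^ 2 = x := Real.sq_sqrt hx0.le
  have h := Real.self_le_sinh_iff.2 (Real.log_nonneg (Real.one_le_sqrt.2 hx.le))
  rw [Real.sinh_log hs, Real.log_sqrt hx0.le] at h
  have h2 : Real.log x * √x ≤ x - 1 := by
    have h3 : Real.log x ≤ √x - (√x)⁻¹ := by linarith
    calc Real.log x * √x ≤ (√x - (√x)⁻¹) * √x := by gcongr
      _ = x - 1 := by rw [sub_mul, inv_mul_cancel₀ hs.ne', ← sq, hsq]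
  have h4 : Real.log x ^ 2 * x ≤ (x - 1) ^ 2 := by
    calc Real.log x ^ 2 * x = (Real.log x * √x) ^ 2 := by rw [mul_pow, hsq]
      _ ≤ _ := by gcongr
  have hx1 : 0 < x - 1 := by linarith
  rw [div_pow, div_le_iff₀ (by positivity), inv_mul_eq_div, le_div_iff₀ hx0]
  exact h4

/-- For every integer `n ≥ 3`,
`√((n−2)/(n−1)) < 2·n^{1/(n−1)} / (n^{2/(n−1)} + 1)`. -/
theorem new_bound_lt_pawlowski_bound (n : ℕ) (hn : 3 ≤ n) :
    Real.sqrt (((n : ℝ) - 2) / ((n : ℝ) - 1)) <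
      2 * (n : ℝ) ^ ((1 : ℝ) / ((n : ℝ) - 1)) /
        ((n : ℝ) ^ ((2 : ℝ) / ((n : ℝ) - 1)) + 1) := by
  have hx : (3 : ℝ) ≤ n := by exact_mod_cast hn
  generalize (n : ℝ) = x at hx ⊢
  have hx0 : 0 < x := by linarith
  have hx1 : 0 < x - 1 := by linarith
  have ht := Real.sq_log_div_sub_one_le_inv (show 1 < x by linarith)
  have h1 : x ^ ((1 : ℝ) / (x - 1)) = Real.exp (Real.log x / (x - 1)) := by
    rw [Real.rpow_def_of_pos hx0, mul_one_div]
  have h2 : x ^ ((2 : ℝ) / (x - 1)) = Real.exp (Real.log x / (x - 1)) ^ 2 := by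
    rw [Real.rpow_def_of_pos hx0, ← Real.exp_nat_mul]
    congr 1
    push_cast
    ring
  rw [h1, h2]
  generalize Real.log x / (x - 1) = t at ht
  have hcosh : 2 * Real.exp t / (Real.exp t ^ 2 + 1) = (Real.cosh t)⁻¹ := by
    rw [Real.cosh_eq, Real.exp_neg]
    field_simp
  have hc := Real.cosh_pos t
  rw [hcosh, Real.sqrt_lt' (inv_pos.2 hc)]
  calc (x - 2) / (x - 1) < -x⁻¹ + 1 := by
        rw [div_lt_iff₀ hx1]
        field_simp
        nlinarith
    _ ≤ Real.exp (-x⁻¹) := Real.add_one_le_exp _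
    _ ≤ Real.exp (-t ^ 2) := by gcongr
    _ = (Real.exp (t ^ 2 / 2))⁻¹ ^ 2 := by
        rw [← Real.exp_neg, ← Real.exp_nat_mul]
        congr 1
        push_cast
        ring
    _ ≤ (Real.cosh t)⁻¹ ^ 2 := by
        gcongr
        exact Real.cosh_le_exp_half_sq t
end

section
/- For every integer n ≥ 3, the real inequality (n^{2/(n−1)} − 1)/(n^{2/(n−1)} + 1) < √(1/(n−1)) holds. -/
theorem Real.one_add_sq_lt_exp {x : ℝ} (hx : 0 < x) : 1 + x ^ 2 < Real.exp x := by
  have h := Real.sum_le_exp_of_nonneg hx.le 4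
  norm_num [Finset.sum_range_succ, Nat.factorial] at h
  nlinarith [mul_pos hx (show 0 < 1 - x / 2 + x ^ 2 / 6 by nlinarith [sq_nonneg (x - 3 / 2)])]

theorem Real.sub_one_div_add_one_le_half_log {x : ℝ} (hx : 1 ≤ x) :
    (x - 1) / (x + 1) ≤ Real.log x / 2 := by
  have h := Real.le_log_one_add_of_nonneg (sub_nonneg.mpr hx)
  rw [add_sub_cancel, show x - 1 + 2 = x + 1 by ring, mul_div_assoc] at h
  linarith

/-- For every integer `n ≥ 3`,
`(n^{2/(n−1)} − 1)/(n^{2/(n−1)} + 1) < √(1/(n−1))`. -/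
theorem ratio_lt_sqrt_inv (n : ℕ) (hn : 3 ≤ n) :
    ((n : ℝ) ^ ((2 : ℝ) / ((n : ℝ) - 1)) - 1) /
        ((n : ℝ) ^ ((2 : ℝ) / ((n : ℝ) - 1)) + 1) <
      Real.sqrt (1 / ((n : ℝ) - 1)) := by
  have hn' : (3 : ℝ) ≤ n := by exact_mod_cast hn
  have hpos : (0 : ℝ) < n - 1 := by linarith
  have hm : 0 < √((n : ℝ) - 1) := Real.sqrt_pos.mpr hpos
  have hsq : √((n : ℝ) - 1) ^ 2 = n - 1 := Real.sq_sqrt hpos.le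
  have hlog : Real.log n < √((n : ℝ) - 1) := by
    rw [Real.log_lt_iff_lt_exp (by linarith)]
    simpa [hsq] using Real.one_add_sq_lt_exp hm
  have hone : 1 ≤ (n : ℝ) ^ ((2 : ℝ) / ((n : ℝ) - 1)) :=
    Real.one_le_rpow (by linarith) (by positivity)
  calc _ ≤ Real.log ((n : ℝ) ^ ((2 : ℝ) / ((n : ℝ) - 1))) / 2 :=
        Real.sub_one_div_add_one_le_half_log hone
    _ = Real.log n / (n - 1) := by
        rw [Real.log_rpow (by linarith)]
        ring
    _ < √((n : ℝ) - 1) / (n - 1) := by gcongr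
    _ = √(1 / ((n : ℝ) - 1)) := by
        rw [Real.sqrt_div_self', Real.sqrt_div zero_le_one, Real.sqrt_one]
end
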